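/- arXiv:cs/0509014 — 6 statements merged into one kernel-verified Lean document; each statement's English description precedes it below -/
import Mathlib

section
/- Let (Y, 𝒜, ν) be a σ-finite measure space and let f_0, f_1 : Y → [0,∞) be measurable with ∫ f_0 dν = ∫ f_1 dν = 1 and f_0 > 0, f_1 > 0 ν-almost everywhere, and let m(y) := ln(f_0(y)/f_1(y)). Define the Borel probability measure μ on ℝ as μ := (1/2)·(pushforward of f_0·ν under m) + (1/2)·(pushforward of f_1·ν under −m). Then μ is self-symmetric: ∫ h(t) dμ(t) = ∫ e^{−t} h(−t) dμ(t) for every measurable h : ℝ → [0,∞]. -/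
open MeasureTheory
open scoped ENNReal

/-- The codeword-averaged log-likelihood-ratio density
`μ = (P(0) + P(1)∘I⁻¹)/2` is self-symmetric:
`∫ h(t) dμ = ∫ e^{-t} h(-t) dμ` for every nonnegative measurable `h`. -/
theorem averaged_llr_self_symmetric
    {Y : Type*} [MeasurableSpace Y] (ν : Measure Y) [SigmaFinite ν]
    (f₀ f₁ : Y → ℝ)
    (hf₀_meas : Measurable f₀) (hf₁_meas : Measurable f₁)
    (hf₀_nonneg : ∀ y, 0 ≤ f₀ y) (hf₁_nonneg : ∀ y, 0 ≤ f₁ y)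
    (hf₀_int : ∫⁻ y, ENNReal.ofReal (f₀ y) ∂ν = 1)
    (hf₁_int : ∫⁻ y, ENNReal.ofReal (f₁ y) ∂ν = 1)
    (hf₀_pos : ∀ᵐ y ∂ν, 0 < f₀ y) (hf₁_pos : ∀ᵐ y ∂ν, 0 < f₁ y)
    (m : Y → ℝ) (hm : ∀ y, m y = Real.log (f₀ y / f₁ y))
    (μ : Measure ℝ)
    (hμ : μ = (2 : ℝ≥0∞)⁻¹
            • ((ν.withDensity (fun y => ENNReal.ofReal (f₀ y))).map m)
          + (2 : ℝ≥0∞)⁻¹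
            • ((ν.withDensity (fun y => ENNReal.ofReal (f₁ y))).map
                (fun y => -(m y)))) :
    ∀ h : ℝ → ℝ≥0∞, Measurable h →
      ∫⁻ t, h t ∂μ = ∫⁻ t, ENNReal.ofReal (Real.exp (-t)) * h (-t) ∂μ := by
  intro h hh
  have hmm : Measurable m := by
    have : m = fun y => Real.log (f₀ y / f₁ y) := funext hm
    rw [this]
    fun_prop
  have key : ∀ g : ℝ → ℝ≥0∞, Measurable g → ∫⁻ t, g t ∂μ =
      2⁻¹ * ∫⁻ y, ENNReal.ofReal (f₀ y) * g (m y) ∂ν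
      + 2⁻¹ * ∫⁻ y, ENNReal.ofReal (f₁ y) * g (-(m y)) ∂ν := by
    intro g hg
    have hn : Measurable (fun y => -(m y)) := hmm.neg
    have hg0 : Measurable (fun y => g (m y)) := hg.comp hmm
    have hg1 : Measurable (fun y => g (-(m y))) := hg.comp hn
    rw [hμ, lintegral_add_measure, lintegral_smul_measure, lintegral_smul_measure,
      lintegral_map hg hmm, lintegral_map hg hn,
      lintegral_withDensity_eq_lintegral_mul _ (by fun_prop) hg0,
      lintegral_withDensity_eq_lintegral_mul _ (by fun_prop) hg1]
    rfl
  rw [key h hh, key (fun t => ENNReal.ofReal (Real.exp (-t)) * h (-t)) (by fun_prop), add_comm]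
  have e : ∀ᵐ y ∂ν, Real.exp (m y) = f₀ y / f₁ y := by
    filter_upwards [hf₀_pos, hf₁_pos] with y h0 h1
    rw [hm, Real.exp_log (div_pos h0 h1)]
  congr 2
  · apply lintegral_congr_ae
    filter_upwards [e, hf₀_pos, hf₁_pos] with y he h0 h1
    rw [← mul_assoc, ← ENNReal.ofReal_mul h0.le, Real.exp_neg, he]
    congr 2
    field_simp
  · apply lintegral_congr_ae
    filter_upwards [e, hf₀_pos, hf₁_pos] with y he h0 h1
    rw [← mul_assoc, ← ENNReal.ofReal_mul h1.le, neg_neg, he]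
    congr 2
    field_simp
end

section
/- Let μ be a self-symmetric Borel probability measure on ℝ, i.e., ∫ h(t) dμ(t) = ∫ e^{−t} h(−t) dμ(t) for every measurable h : ℝ → [0,∞]. Then for every s ∈ ℝ, ∫ e^{−t/2} dμ(t) ≤ ∫ e^{−s·t} dμ(t) (as an inequality in [0,∞]). In other words, the exponent s = 1/2 minimizes the moment generating function s ↦ ∫ e^{−s·t} dμ(t), so the Bhattacharyya parameter ∫ e^{−t/2} dμ equals min_s ∫ e^{−s·t} dμ. -/
open MeasureTheory
open scoped ENNReal

/-- For a self-symmetric probability measure `μ` on `ℝ`, the exponent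
`s = 1/2` minimizes the moment generating function `s ↦ ∫ e^{-s t} dμ`,
so the Bhattacharyya parameter `∫ e^{-t/2} dμ` equals
`min_s ∫ e^{-s t} dμ`. -/
theorem self_symmetric_chernoff_min
    (μ : Measure ℝ) [IsProbabilityMeasure μ]
    (hsym : ∀ h : ℝ → ℝ≥0∞, Measurable h →
      ∫⁻ t, h t ∂μ = ∫⁻ t, ENNReal.ofReal (Real.exp (-t)) * h (-t) ∂μ) :
    ∀ s : ℝ,
      ∫⁻ t, ENNReal.ofReal (Real.exp (-t / 2)) ∂μ
        ≤ ∫⁻ t, ENNReal.ofReal (Real.exp (-s * t)) ∂μ := by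
  intro s
  have key := hsym (fun t => ENNReal.ofReal (Real.exp (-s * t))) (by fun_prop)
  have h2 : 2 * ∫⁻ t, ENNReal.ofReal (Real.exp (-t / 2)) ∂μ
      ≤ 2 * ∫⁻ t, ENNReal.ofReal (Real.exp (-s * t)) ∂μ := by
    conv_rhs => rw [two_mul]
    conv_rhs => arg 2; rw [key]
    rw [← lintegral_add_left (by fun_prop), ← lintegral_const_mul _ (by fun_prop)]
    refine lintegral_mono fun t => ?_
    simp only
    rw [← ENNReal.ofReal_mul (Real.exp_pos _).le,
      ← ENNReal.ofReal_add (Real.exp_pos _).le (by positivity),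
      show (2 : ℝ≥0∞) = ENNReal.ofReal 2 by simp, ← ENNReal.ofReal_mul (by norm_num)]
    apply ENNReal.ofReal_le_ofReal
    have e1 : Real.exp (-t) * Real.exp (-s * -t)
        = Real.exp ((s * t - t) / 2) * Real.exp ((s * t - t) / 2) := by
      rw [← Real.exp_add, ← Real.exp_add]; congr 1; ring
    have e2 : Real.exp (-s * t) = Real.exp (-s * t / 2) * Real.exp (-s * t / 2) := by
      rw [← Real.exp_add]; congr 1; ring
    have e3 : Real.exp (-t / 2) = Real.exp (-s * t / 2) * Real.exp ((s * t - t) / 2) := by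
      rw [← Real.exp_add]; congr 1; ring
    rw [e1, e2, e3]
    nlinarith [sq_nonneg (Real.exp (-s * t / 2) - Real.exp ((s * t - t) / 2))]
  exact (ENNReal.mul_le_mul_iff_right (by norm_num) (by norm_num)).1 h2
end

section
/- Let μ be a self-symmetric Borel probability measure on ℝ with μ({0}) = 0, and set p_e := μ((−∞,0)). Then 2·p_e ≤ ∫ e^{−t/2} dμ(t) ≤ 2·√(p_e·(1−p_e)), where the middle quantity is allowed to take values in [0,∞] and the inequalities are interpreted accordingly. -/
open MeasureTheory
open scoped ENNReal

/-- For a self-symmetric probability measure `μ` on `ℝ` with `μ {0} = 0`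
and error probability `p_e = μ (-∞, 0)`, the Bhattacharyya parameter
`∫ e^{-t/2} dμ` satisfies `2 p_e ≤ ∫ e^{-t/2} dμ ≤ 2 √(p_e (1 - p_e))`. -/
theorem self_symmetric_chernoff_error_bounds
    (μ : Measure ℝ) [IsProbabilityMeasure μ]
    (hsym : ∀ h : ℝ → ℝ≥0∞, Measurable h →
      ∫⁻ t, h t ∂μ = ∫⁻ t, ENNReal.ofReal (Real.exp (-t)) * h (-t) ∂μ)
    (hzero : μ {0} = 0)
    (pe : ℝ) (hpe : pe = (μ (Set.Iio 0)).toReal) :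
    ENNReal.ofReal (2 * pe) ≤ ∫⁻ t, ENNReal.ofReal (Real.exp (-t / 2)) ∂μ ∧
    ∫⁻ t, ENNReal.ofReal (Real.exp (-t / 2)) ∂μ
      ≤ ENNReal.ofReal (2 * Real.sqrt (pe * (1 - pe))) := by
  have hm : Measurable (fun t : ℝ => ENNReal.ofReal (Real.exp (-t / 2))) := by fun_prop
  have hm1 : Measurable (fun t : ℝ => ENNReal.ofReal (Real.exp (-t))) := by fun_prop
  -- symmetry for the half-weight
  have h1 : ∫⁻ t in Set.Iio 0, ENNReal.ofReal (Real.exp (-t / 2)) ∂μ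
      = ∫⁻ t in Set.Ioi 0, ENNReal.ofReal (Real.exp (-t / 2)) ∂μ := by
    rw [← lintegral_indicator measurableSet_Iio, ← lintegral_indicator measurableSet_Ioi,
      hsym _ (hm.indicator measurableSet_Iio)]
    refine lintegral_congr fun t => ?_
    by_cases ht : 0 < t
    · rw [Set.indicator_of_mem (by simpa using ht), Set.indicator_of_mem (by simpa using ht),
        ← ENNReal.ofReal_mul (Real.exp_pos _).le, ← Real.exp_add]
      congr 2
      ring
    · rw [Set.indicator_of_notMem (by simpa using ht), Set.indicator_of_notMem (by simpa using ht),
        mul_zero]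
  have h2 : μ (Set.Iio 0) = ∫⁻ t in Set.Ioi 0, ENNReal.ofReal (Real.exp (-t)) ∂μ := by
    rw [← lintegral_indicator_one measurableSet_Iio, ← lintegral_indicator measurableSet_Ioi,
      hsym _ (measurable_one.indicator measurableSet_Iio)]
    refine lintegral_congr fun t => ?_
    by_cases ht : 0 < t
    · rw [Set.indicator_of_mem (by simpa using ht), Set.indicator_of_mem (by simpa using ht)]
      simp
    · rw [Set.indicator_of_notMem (by simpa using ht), Set.indicator_of_notMem (by simpa using ht),
        mul_zero]
  have hae : (Set.Ici (0:ℝ)) =ᵐ[μ] Set.Ioi 0 := (Ioi_ae_eq_Ici' hzero).symm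
  have hB : ∫⁻ t, ENNReal.ofReal (Real.exp (-t / 2)) ∂μ
      = 2 * ∫⁻ t in Set.Ioi 0, ENNReal.ofReal (Real.exp (-t / 2)) ∂μ := by
    rw [← lintegral_add_compl _ (measurableSet_Iio (a := (0:ℝ))), Set.compl_Iio,
      setLIntegral_congr hae, h1, two_mul]
  have hQ : μ (Set.Ioi 0) = ENNReal.ofReal (1 - pe) := by
    have hc := prob_compl_eq_one_sub (μ := μ) (measurableSet_Iio (a := (0:ℝ)))
    rw [Set.compl_Iio, measure_congr hae] at hc
    rw [hc, hpe, ENNReal.ofReal_sub _ ENNReal.toReal_nonneg, ENNReal.ofReal_one,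
      ENNReal.ofReal_toReal (measure_ne_top _ _)]
  have hP : μ (Set.Iio 0) = ENNReal.ofReal pe := by
    rw [hpe, ENNReal.ofReal_toReal (measure_ne_top _ _)]
  have hpe0 : 0 ≤ pe := hpe ▸ ENNReal.toReal_nonneg
  have hpe1 : 0 ≤ 1 - pe := by
    have : (μ (Set.Iio 0)).toReal ≤ 1 := measureReal_le_one
    linarith
  constructor
  · rw [hB, ← h1, ENNReal.ofReal_mul (by norm_num), ← hP, ENNReal.ofReal_ofNat]
    gcongr
    rw [← setLIntegral_one]
    refine setLIntegral_mono hm fun t ht => ?_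
    rw [← ENNReal.ofReal_one]
    apply ENNReal.ofReal_le_ofReal
    have : t < 0 := ht
    exact Real.one_le_exp (by linarith)
  · rw [hB, ENNReal.ofReal_mul (by norm_num), ENNReal.ofReal_ofNat]
    gcongr
    have hcs := ENNReal.lintegral_mul_le_Lp_mul_Lq (μ.restrict (Set.Ioi 0))
      (Real.HolderConjugate.two_two) hm.aemeasurable
      (aemeasurable_const (b := (1 : ℝ≥0∞)))
    have hsq : ∀ t : ℝ, ENNReal.ofReal (Real.exp (-t / 2)) ^ (2:ℝ)
        = ENNReal.ofReal (Real.exp (-t)) := by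
      intro t
      rw [ENNReal.ofReal_rpow_of_pos (Real.exp_pos _), ← Real.exp_mul]
      congr 2
      ring
    simp only [Pi.mul_apply, mul_one, hsq, ENNReal.one_rpow, setLIntegral_one] at hcs
    rw [← h2, hP, hQ, ← ENNReal.mul_rpow_of_nonneg _ _ (by norm_num),
      ← ENNReal.ofReal_mul hpe0, ENNReal.ofReal_rpow_of_nonneg (mul_nonneg hpe0 hpe1) (by norm_num),
      ← Real.sqrt_eq_rpow] at hcs
    exact hcs
end

section
/- For every n ≥ 1 and all real numbers m_1, …, m_n, one has exp(−artanh(∏_{i=1}^{n} tanh(m_i/2))) ≤ Σ_{i=1}^{n} exp(−m_i/2). Equivalently, writing Ψ_c(m_1,…,m_n) := ln((1 + ∏_i tanh(m_i/2))/(1 − ∏_i tanh(m_i/2))) for the belief-propagation check node map, exp(−Ψ_c(m_1,…,m_n)/2) ≤ Σ_{i=1}^{n} exp(−m_i/2). -/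
open Finset

/-- Inverse hyperbolic tangent: `artanh x = (1/2) ln ((1+x)/(1-x))`. -/
noncomputable def artanh (x : ℝ) : ℝ := Real.log ((1 + x) / (1 - x)) / 2

/-- The belief-propagation check node map on log-likelihood-ratio
messages: `Ψ_c (m₁,…,m_n) = ln ((1 + ∏ tanh(mᵢ/2)) / (1 - ∏ tanh(mᵢ/2)))`. -/
noncomputable def checkNodeMap {n : ℕ} (m : Fin n → ℝ) : ℝ :=
  Real.log ((1 + ∏ i, Real.tanh (m i / 2)) / (1 - ∏ i, Real.tanh (m i / 2)))

lemma tanh_half_eq (x : ℝ) :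
    Real.tanh (x / 2) = (1 - Real.exp (-x / 2) ^ 2) / (1 + Real.exp (-x / 2) ^ 2) := by
  have h : Real.exp (-x / 2) = (Real.exp (x / 2))⁻¹ := by
    rw [← Real.exp_neg]; congr 1; ring
  rw [Real.tanh_eq_sinh_div_cosh, Real.sinh_eq, Real.cosh_eq, Real.exp_neg, h]
  have := Real.exp_pos (x / 2)
  field_simp

lemma prod_aux {n : ℕ} (m : Fin n → ℝ) (s : Finset (Fin n)) :
    ∃ q : ℝ, 0 ≤ q ∧ (s.Nonempty → 0 < q) ∧
      ∏ i ∈ s, Real.tanh (m i / 2) = (1 - q) / (1 + q) ∧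
      q ≤ (∑ i ∈ s, Real.exp (-(m i) / 2)) ^ 2 := by
  induction s using Finset.induction_on with
  | empty => exact ⟨0, by simp⟩
  | insert j s hj ih =>
    obtain ⟨q, hq, -, hP, hS⟩ := ih
    have hS0 : 0 ≤ ∑ i ∈ s, Real.exp (-(m i) / 2) :=
      Finset.sum_nonneg fun i _ => (Real.exp_pos _).le
    rw [Finset.prod_insert hj, Finset.sum_insert hj, hP, tanh_half_eq]
    have ha := Real.exp_pos (-(m j) / 2)
    generalize Real.exp (-(m j) / 2) = a at *
    generalize ∑ i ∈ s, Real.exp (-(m i) / 2) = S at *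
    have h1 : 0 < 1 + a ^ 2 * q := by positivity
    have h2 : 0 < (a ^ 2 + q) / (1 + a ^ 2 * q) := by positivity
    refine ⟨(a ^ 2 + q) / (1 + a ^ 2 * q), h2.le, fun _ => h2, ?_, ?_⟩
    · have h3 : 1 + (a ^ 2 + q) / (1 + a ^ 2 * q) ≠ 0 := by positivity
      have h4 : 1 + a ^ 2 ≠ 0 := by positivity
      have h5 : 1 + q ≠ 0 := by positivity
      rw [div_mul_div_comm, div_eq_div_iff (mul_ne_zero h4 h5) h3]
      field_simp
      ring
    · have h3 : (a ^ 2 + q) / (1 + a ^ 2 * q) ≤ a ^ 2 + q :=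
        div_le_self (by positivity) (by nlinarith [mul_nonneg (sq_nonneg a) hq])
      nlinarith [mul_nonneg ha.le hS0]

theorem checkNode_chernoff_subadditive (n : ℕ) (hn : 1 ≤ n) (m : Fin n → ℝ) :
    Real.exp (-(artanh (∏ i, Real.tanh (m i / 2))))
        ≤ ∑ i, Real.exp (-(m i) / 2) ∧
    Real.exp (-(checkNodeMap m) / 2) ≤ ∑ i, Real.exp (-(m i) / 2) := by
  have key : Real.exp (-(checkNodeMap m) / 2) ≤ ∑ i, Real.exp (-(m i) / 2) := by
    obtain ⟨q, -, hq, hP, hS⟩ := prod_aux m Finset.univ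
    have hq : 0 < q := hq ⟨⟨0, hn⟩, Finset.mem_univ _⟩
    have hS0 : 0 ≤ ∑ i, Real.exp (-(m i) / 2) :=
      Finset.sum_nonneg fun i _ => (Real.exp_pos _).le
    have e : (1 + (1 - q) / (1 + q)) / (1 - (1 - q) / (1 + q)) = q⁻¹ := by
      have h5 : 1 + q ≠ 0 := by positivity
      have h6 : 1 - (1 - q) / (1 + q) = 2 * q / (1 + q) := by field_simp; ring
      rw [h6]; field_simp; ring
    refine (pow_le_pow_iff_left₀ (Real.exp_pos _).le hS0 two_ne_zero).1 ?_
    rw [checkNodeMap, hP, e, Real.log_inv, neg_neg, ← Real.exp_nat_mul]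
    have : ((2 : ℕ) : ℝ) * (Real.log q / 2) = Real.log q := by push_cast; ring
    rw [this, Real.exp_log hq]
    exact hS
  refine ⟨?_, key⟩
  have : -(artanh (∏ i, Real.tanh (m i / 2))) = -(checkNodeMap m) / 2 := by
    rw [artanh, checkNodeMap]; ring
  rw [this]; exact key
end

section
/- For every natural number k ≥ 1 and all natural numbers i, n with 0 < i < n, the binomial coefficients satisfy C(n,i)/C(kn,ki) ≤ √k · e^{1/6} · 2^{−(k−1)·n·H_2(i/n)}, where H_2(p) := −p·log_2(p) − (1−p)·log_2(1−p) is the binary entropy function. -/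
/-- The binary entropy function with logarithm base 2:
`H₂ p = -p log₂ p - (1-p) log₂ (1-p)`. -/
noncomputable def binaryEntropy2 (p : ℝ) : ℝ :=
  -(p * Real.logb 2 p) - (1 - p) * Real.logb 2 (1 - p)

theorem aux_log_fact (m : ℕ) (hm : 0 < m) :
    Real.log (m.factorial : ℝ) = Real.log (Stirling.stirlingSeq m)
      + 1 / 2 * (Real.log 2 + Real.log m) + m * Real.log m - m := by
  have h := Stirling.log_stirlingSeq_formula m
  have hm' : (m : ℝ) ≠ 0 := by positivity
  rw [Real.log_mul two_ne_zero hm', Real.log_div hm' (Real.exp_ne_zero 1), Real.log_exp] at h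
  linarith

theorem aux_anti (a b : ℕ) (ha : 0 < a) (hab : a ≤ b) :
    Real.log (Stirling.stirlingSeq b) ≤ Real.log (Stirling.stirlingSeq a) := by
  obtain ⟨a, rfl⟩ := Nat.exists_eq_succ_of_ne_zero ha.ne'
  obtain ⟨b, rfl⟩ := Nat.exists_eq_succ_of_ne_zero (show b ≠ 0 by omega)
  exact Stirling.log_stirlingSeq'_antitone (Nat.le_of_succ_le_succ hab)

theorem aux_gap (a b : ℕ) (ha : 0 < a) (hb : 0 < b) :
    Real.log (Stirling.stirlingSeq a) - Real.log (Stirling.stirlingSeq b) ≤ 1 / 6 := by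
  have h1 := aux_anti 1 a one_pos ha
  obtain ⟨b, rfl⟩ := Nat.exists_eq_succ_of_ne_zero hb.ne'
  have h2 := Stirling.log_stirlingSeq_bounded_aux b
  have : Real.log (Stirling.stirlingSeq (b.succ)) = Real.log (Stirling.stirlingSeq (b + 1)) := rfl
  rw [this]
  have h3 : (12 : ℝ)⁻¹ ≤ 1 / 6 := by norm_num
  linarith

theorem aux_log_choose (i j : ℕ) :
    Real.log ((i + j).choose i : ℝ) = Real.log ((i + j).factorial : ℝ)
      - Real.log (i.factorial : ℝ) - Real.log (j.factorial : ℝ) := by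
  have h := Nat.add_choose_mul_factorial_mul_factorial i j
  have hc : ((i + j).choose i : ℝ) ≠ 0 := by
    exact_mod_cast (Nat.choose_pos (Nat.le_add_right i j)).ne'
  have h1 : (i.factorial : ℝ) ≠ 0 := by exact_mod_cast i.factorial_ne_zero
  have h2 : (j.factorial : ℝ) ≠ 0 := by exact_mod_cast j.factorial_ne_zero
  rw [← Nat.choose_symm_add] at h
  rw [← h]
  push_cast
  rw [Real.log_mul (mul_ne_zero hc h1) h2, Real.log_mul hc h1]
  ring

/-- Binomial ratio lemma (via Stirling's double inequality): for `k ≥ 1` and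
`0 < i < n`, `C(n,i)/C(kn,ki) ≤ √k · e^{1/6} · 2^{-(k-1) n H₂(i/n)}`. -/
theorem choose_ratio_entropy_bound (k i n : ℕ) (hk : 0 < k)
    (hi : 0 < i) (hin : i < n) :
    (n.choose i : ℝ) / ((k * n).choose (k * i) : ℝ)
      ≤ Real.sqrt k * Real.exp (1 / 6)
          * (2 : ℝ) ^ (-(((k : ℝ) - 1) * n * binaryEntropy2 ((i : ℝ) / n))) := by
  obtain ⟨j, rfl⟩ := Nat.exists_eq_add_of_lt hin
  obtain ⟨j', hj'⟩ : ∃ j', j' = j + 1 := ⟨_, rfl⟩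
  rw [add_assoc, ← hj']
  have hj : 0 < j' := by omega
  clear hj' hin
  have hkR : (0 : ℝ) < k := by exact_mod_cast hk
  have hiR : (0 : ℝ) < i := by exact_mod_cast hi
  have hjR : (0 : ℝ) < j' := by exact_mod_cast hj
  have hnR : (0 : ℝ) < (i : ℝ) + j' := by positivity
  have hc1 : (0 : ℝ) < ((i + j').choose i : ℝ) := by
    exact_mod_cast Nat.choose_pos (Nat.le_add_right i j')
  have hc2 : (0 : ℝ) < ((k * (i + j')).choose (k * i) : ℝ) := by
    exact_mod_cast Nat.choose_pos (Nat.mul_le_mul_left k (Nat.le_add_right i j'))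
  rw [← Real.log_le_log_iff (by positivity) (by positivity)]
  rw [Real.log_div hc1.ne' hc2.ne', Real.log_mul (by positivity) (by positivity),
    Real.log_mul (by positivity) (by positivity), Real.log_exp,
    Real.log_rpow two_pos, Real.log_sqrt hkR.le]
  have hH : (((i + j' : ℕ) : ℝ)) * binaryEntropy2 ((i : ℝ) / ((i + j' : ℕ) : ℝ)) * Real.log 2
      = (i + j') * Real.log (i + j') - i * Real.log i - j' * Real.log j' := by
    have hl : Real.log 2 ≠ 0 := (Real.log_pos one_lt_two).ne'
    push_cast
    have e : 1 - (i : ℝ) / (i + j') = j' / (i + j') := by field_simp; ring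
    unfold binaryEntropy2
    rw [e, Real.logb, Real.logb, Real.log_div hiR.ne' hnR.ne', Real.log_div hjR.ne' hnR.ne']
    field_simp
    ring
  have hH2 : -(((k : ℝ) - 1) * ((i + j' : ℕ) : ℝ) *
        binaryEntropy2 ((i : ℝ) / ((i + j' : ℕ) : ℝ))) * Real.log 2
      = -((k : ℝ) - 1) *
        ((i + j') * Real.log (i + j') - i * Real.log i - j' * Real.log j') := by
    rw [← hH]; ring
  rw [hH2]
  have A := aux_log_choose i j'
  have B := aux_log_choose (k * i) (k * j')
  rw [← mul_add] at B
  have g1 := aux_gap (i + j') (k * (i + j')) (by omega) (by positivity)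
  have g2 := aux_anti i (k * i) hi (Nat.le_mul_of_pos_left i hk)
  have g3 := aux_anti j' (k * j') hj (Nat.le_mul_of_pos_left j' hk)
  rw [aux_log_fact _ (by positivity), aux_log_fact i hi, aux_log_fact j' hj] at A
  rw [aux_log_fact _ (by positivity), aux_log_fact (k * i) (by positivity),
    aux_log_fact (k * j') (by positivity)] at B
  rw [A, B]
  push_cast
  rw [Real.log_mul hkR.ne' hnR.ne', Real.log_mul hkR.ne' hiR.ne', Real.log_mul hkR.ne' hjR.ne']
  linarith
end

section
/- For all natural numbers i, n with 0 < i < n, the binomial coefficient satisfies e^{−1/6} < C(n,i) / ( (1/√(2π)) · 2^{n·H_2(i/n)} · √(n/(i·(n−i))) ) < 1, where H_2(p) := −p·log_2(p) − (1−p)·log_2(1−p) is the binary entropy function. -/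
theorem aux_log_gt (k : ℕ) (hk : k ≠ 0) :
    Real.log (√Real.pi) < Real.log (Stirling.stirlingSeq k) := by
  obtain ⟨m, rfl⟩ := Nat.exists_eq_succ_of_ne_zero hk
  have h1 : 0 < Real.log (Stirling.stirlingSeq (m + 1)) - Real.log (Stirling.stirlingSeq (m + 2)) :=
    hasSum_lt (i := 0) (f := fun _ => 0) (fun k => by positivity) (by positivity) hasSum_zero (Stirling.log_stirlingSeq_sdiff_hasSum m)
  have h2 : Real.log (√Real.pi) ≤ Real.log (Stirling.stirlingSeq (m + 2)) :=
    Real.log_le_log (Real.sqrt_pos.mpr Real.pi_pos)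
      (Stirling.sqrt_pi_le_stirlingSeq (by omega))
  simp only [Nat.succ_eq_add_one]
  linarith

theorem aux_log_anti (k l : ℕ) (hk : k ≠ 0) (hl : k ≤ l) :
    Real.log (Stirling.stirlingSeq l) ≤ Real.log (Stirling.stirlingSeq k) := by
  obtain ⟨m, rfl⟩ := Nat.exists_eq_succ_of_ne_zero hk
  obtain ⟨p, rfl⟩ := Nat.exists_eq_succ_of_ne_zero (n := l) (by omega)
  exact Stirling.log_stirlingSeq'_antitone (Nat.succ_le_succ_iff.mp hl)

theorem aux_log_le (k : ℕ) (hk : k ≠ 0) :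
    Real.log (Stirling.stirlingSeq k) ≤ Real.log (√Real.pi) + 1 / 12 := by
  have h1 := aux_log_anti 1 k one_ne_zero (by omega)
  have hpi : √Real.pi ≠ 0 := (Real.sqrt_pos.mpr Real.pi_pos).ne'
  have h2 : Filter.Tendsto (fun n : ℕ => Real.log (Stirling.stirlingSeq (n + 1))) Filter.atTop
      (nhds (Real.log (√Real.pi))) :=
    ((Stirling.tendsto_stirlingSeq_sqrt_pi.comp (Filter.tendsto_add_atTop_nat 1))).log hpi
  have h3 : Real.log (Stirling.stirlingSeq 1) - 1 / 12 ≤ Real.log (√Real.pi) :=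
    ge_of_tendsto' h2 fun n => by
      have := Stirling.log_stirlingSeq_bounded_aux n
      norm_num at this ⊢
      linarith
  linarith

theorem aux_formula (i m : ℕ) (hi : 0 < i) (hm : 0 < m) :
    Real.log (((i + m).choose i : ℝ)
          / ((1 / Real.sqrt (2 * Real.pi))
              * (2 : ℝ) ^ (((i + m : ℕ) : ℝ) * binaryEntropy2 ((i : ℝ) / (i + m : ℕ)))
              * Real.sqrt (((i + m : ℕ) : ℝ) / ((i : ℝ) * (((i + m : ℕ) : ℝ) - (i : ℝ))))))
      = Real.log (Stirling.stirlingSeq (i + m)) - Real.log (Stirling.stirlingSeq i)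
        - Real.log (Stirling.stirlingSeq m) + Real.log (√Real.pi) := by
  have hpi := Real.pi_pos
  have hi' : (0 : ℝ) < i := by exact_mod_cast hi
  have hm' : (0 : ℝ) < m := by exact_mod_cast hm
  have hl2 : Real.log 2 ≠ 0 := (Real.log_pos (by norm_num)).ne'
  have hc : Real.log ((i + m).choose i : ℝ) = Real.log ((i + m).factorial : ℝ)
      - Real.log (i.factorial : ℝ) - Real.log (m.factorial : ℝ) := by
    rw [Nat.cast_add_choose, Real.log_div (by positivity) (by positivity),
      Real.log_mul (by positivity) (by positivity)]
    ring
  have hsub : ((i + m : ℕ) : ℝ) - (i : ℝ) = m := by push_cast; ring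
  have hH : ((i + m : ℕ) : ℝ) * binaryEntropy2 ((i : ℝ) / (i + m : ℕ)) * Real.log 2
      = (i + m) * Real.log (i + m : ℝ) - i * Real.log i - m * Real.log m := by
    have h1 : 1 - (i : ℝ) / (i + m : ℕ) = m / (i + m) := by
      push_cast; field_simp; ring
    unfold binaryEntropy2
    rw [h1, Real.logb, Real.logb, Real.log_div hm'.ne' (by positivity)]
    push_cast
    rw [Real.log_div hi'.ne' (by positivity)]
    field_simp
    ring
  have hch : ((i + m).choose i : ℝ) ≠ 0 := by
    exact_mod_cast (Nat.choose_pos (Nat.le_add_right i m)).ne'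
  rw [hsub, Real.log_div hch (by positivity), Real.log_mul (by positivity) (by positivity),
    Real.log_mul (by positivity) (by positivity), Real.log_rpow (by norm_num), hH, hc,
    Real.log_div one_ne_zero (by positivity), Real.log_one, Real.log_sqrt (by positivity),
    Real.log_sqrt (by positivity), Real.log_sqrt (by positivity),
    Real.log_mul two_ne_zero hpi.ne', Real.log_div (by positivity) (by positivity),
    Real.log_mul hi'.ne' hm'.ne', Stirling.log_stirlingSeq_formula,
    Stirling.log_stirlingSeq_formula, Stirling.log_stirlingSeq_formula,
    Real.log_div (by positivity) (by positivity), Real.log_div (by positivity) (by positivity),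
    Real.log_div (by positivity) (by positivity), Real.log_exp,
    Real.log_mul two_ne_zero (by positivity), Real.log_mul two_ne_zero (by positivity),
    Real.log_mul two_ne_zero (by positivity)]
  push_cast
  ring

/-- Two-sided entropy estimate for binomial coefficients (from Stirling's
double inequality): for `0 < i < n`,
`e^{-1/6} < C(n,i) / ((1/√(2π)) 2^{n H₂(i/n)} √(n/(i(n-i)))) < 1`. -/
theorem choose_entropy_two_sided (i n : ℕ) (hi : 0 < i) (hin : i < n) :
    Real.exp (-(1 / 6))
        < (n.choose i : ℝ)
          / ((1 / Real.sqrt (2 * Real.pi))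
              * (2 : ℝ) ^ ((n : ℝ) * binaryEntropy2 ((i : ℝ) / n))
              * Real.sqrt ((n : ℝ) / ((i : ℝ) * ((n : ℝ) - (i : ℝ))))) ∧
    (n.choose i : ℝ)
          / ((1 / Real.sqrt (2 * Real.pi))
              * (2 : ℝ) ^ ((n : ℝ) * binaryEntropy2 ((i : ℝ) / n))
              * Real.sqrt ((n : ℝ) / ((i : ℝ) * ((n : ℝ) - (i : ℝ))))) < 1 := by
  obtain ⟨m, rfl⟩ := Nat.exists_eq_add_of_le hin.le
  have hm : 0 < m := by omega
  have hf := aux_formula i m hi hm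
  have hch : (0 : ℝ) < ((i + m).choose i : ℝ) := by
    exact_mod_cast Nat.choose_pos (Nat.le_add_right i m)
  have hpi := Real.pi_pos
  have hi' : (0 : ℝ) < i := by exact_mod_cast hi
  have hm' : (0 : ℝ) < m := by exact_mod_cast hm
  have hsub : ((i + m : ℕ) : ℝ) - (i : ℝ) = m := by push_cast; ring
  have hpos : 0 < ((i + m).choose i : ℝ)
          / ((1 / Real.sqrt (2 * Real.pi))
              * (2 : ℝ) ^ (((i + m : ℕ) : ℝ) * binaryEntropy2 ((i : ℝ) / (i + m : ℕ)))
              * Real.sqrt (((i + m : ℕ) : ℝ) / ((i : ℝ) * (((i + m : ℕ) : ℝ) - (i : ℝ))))) := by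
    rw [hsub]
    positivity
  have h1 := aux_log_gt (i + m) (by omega)
  have h2 := aux_log_gt m (by omega)
  have h3 := aux_log_le i (by omega)
  have h4 := aux_log_le m (by omega)
  have h5 := aux_log_anti i (i + m) (by omega) (by omega)
  constructor
  · rw [← Real.lt_log_iff_exp_lt hpos, hf]
    linarith
  · rw [← Real.log_neg_iff hpos, hf]
    linarith
end
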